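/- Let W be a nonempty finite type, c : W → ℝ with 0 < c w for all w, T a positive natural number, and f : ℕ → (W → ℝ) a sequence of parameters such that for every t < T and every w ∈ W, P_{f (t+1)} w = Q_{f t} w (exact posterior updates). Then there exists t < T such that KL(P_{f (t+1)} ‖ P_{f t}) ≤ (Real.log (L(f T)) - Real.log (L(f 0))) / T. -/

import Mathlib

/-- The softmax (Gibbs) distribution associated with logits `f`. -/
noncomputable def softmax {W : Type*} [Fintype W] (f : W → ℝ) (w : W) : ℝ :=
  Real.exp (f w) / ∑ w', Real.exp (f w')

/-- The log-partition function of the logits `f`. -/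
noncomputable def logPartition {W : Type*} [Fintype W] (f : W → ℝ) : ℝ :=
  Real.log (∑ w, Real.exp (f w))

/-- Kullback–Leibler divergence between finitely supported densities `p` and `q`
(with the convention `0 * log 0 = 0`, which holds definitionally in `ℝ`). -/
noncomputable def KLdiv {W : Type*} [Fintype W] (p q : W → ℝ) : ℝ :=
  ∑ w, p w * Real.log (p w / q w)

/-- Marginal likelihood: the `c`-weighted total mass of the softmax distribution of `f`. -/
noncomputable def margL {W : Type*} [Fintype W] (c f : W → ℝ) : ℝ :=
  ∑ w, c w * softmax f w

/-- Posterior distribution obtained by reweighting the softmax distribution of `f`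
by the evaluation weights `c` and normalizing. -/
noncomputable def post {W : Type*} [Fintype W] (c f : W → ℝ) (w : W) : ℝ :=
  c w * softmax f w / margL c f

theorem softmax_pos {W : Type*} [Fintype W] (f : W → ℝ) (w : W) : 0 < softmax f w :=
  div_pos (Real.exp_pos _)
    (Finset.sum_pos (fun _ _ => Real.exp_pos _) ⟨w, Finset.mem_univ w⟩)

theorem sum_softmax {W : Type*} [Fintype W] [Nonempty W] (f : W → ℝ) :
    ∑ w, softmax f w = 1 := by
  simp only [softmax, ← Finset.sum_div]
  exact div_self (Finset.sum_pos (fun _ _ => Real.exp_pos _) Finset.univ_nonempty).ne'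

theorem margL_pos {W : Type*} [Fintype W] [Nonempty W] {c : W → ℝ} (hc : ∀ w, 0 < c w)
    (f : W → ℝ) : 0 < margL c f :=
  Finset.sum_pos (fun w _ => mul_pos (hc w) (softmax_pos f w)) Finset.univ_nonempty

/-- A posterior update increases the log marginal likelihood by at least the KL divergence
from the old distribution to the new one. -/
theorem KLdiv_softmax_le_of_eq_post {W : Type*} [Fintype W] [Nonempty W] {c : W → ℝ}
    (hc : ∀ w, 0 < c w) {f g : W → ℝ} (h : ∀ w, softmax g w = post c f w) :
    KLdiv (softmax g) (softmax f) ≤ Real.log (margL c g) - Real.log (margL c f) := by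
  have hf := margL_pos hc f
  have hg := margL_pos hc g
  have key (w : W) : softmax g w * Real.log (softmax g w / softmax f w) ≤
      c w * softmax g w / margL c g +
        softmax g w * (Real.log (margL c g) - Real.log (margL c f) - 1) := by
    have hratio : softmax g w / softmax f w = c w / margL c f := by
      have := (softmax_pos f w).ne'
      rw [h, post]
      field_simp
    have hlog := Real.log_le_sub_one_of_pos (div_pos (hc w) hg)
    rw [Real.log_div (hc w).ne' hg.ne'] at hlog
    rw [hratio, Real.log_div (hc w).ne' hf.ne']
    calc softmax g w * (Real.log (c w) - Real.log (margL c f))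
        ≤ softmax g w *
            (c w / margL c g + (Real.log (margL c g) - Real.log (margL c f) - 1)) :=
          mul_le_mul_of_nonneg_left (by linarith) (softmax_pos g w).le
      _ = _ := by ring
  calc KLdiv (softmax g) (softmax f)
      ≤ ∑ w, (c w * softmax g w / margL c g +
          softmax g w * (Real.log (margL c g) - Real.log (margL c f) - 1)) :=
        Finset.sum_le_sum fun w _ => key w
    _ = margL c g / margL c g + (Real.log (margL c g) - Real.log (margL c f) - 1) := by
        rw [Finset.sum_add_distrib, ← Finset.sum_div, ← Finset.sum_mul, sum_softmax, one_mul,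
          ← margL]
    _ = Real.log (margL c g) - Real.log (margL c f) := by
        rw [div_self hg.ne']
        ring

/-- Theorem B.1 of the paper: along a sequence of exact posterior updates, some
consecutive pair within the first `T` iterations has KL divergence at most
`(log L(f T) - log L(f 0)) / T`. -/
theorem exists_klDiv_le_of_posterior_updates {W : Type*} [Fintype W] [Nonempty W]
    (c : W → ℝ) (hc : ∀ w, 0 < c w) (T : ℕ) (hT : 0 < T) (f : ℕ → W → ℝ)
    (hupd : ∀ t < T, ∀ w, softmax (f (t + 1)) w = post c (f t) w) :
    ∃ t < T, KLdiv (softmax (f (t + 1))) (softmax (f t)) ≤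
      (Real.log (margL c (f T)) - Real.log (margL c (f 0))) / T := by
  by_contra! hlt
  have hsum : ∑ _t ∈ Finset.range T,
      (Real.log (margL c (f T)) - Real.log (margL c (f 0))) / T <
      ∑ t ∈ Finset.range T, (Real.log (margL c (f (t + 1))) - Real.log (margL c (f t))) :=
    Finset.sum_lt_sum_of_nonempty (Finset.nonempty_range_iff.2 hT.ne') fun t ht =>
      (hlt t (Finset.mem_range.1 ht)).trans_le
        (KLdiv_softmax_le_of_eq_post hc (hupd t (Finset.mem_range.1 ht)))
  rw [Finset.sum_range_sub (fun t => Real.log (margL c (f t))), Finset.sum_const,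
    Finset.card_range, nsmul_eq_mul, mul_div_cancel₀ _ (Nat.cast_ne_zero.2 hT.ne')] at hsum
  exact hsum.false
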